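/- A finite simple graph G belongs to quasi-Chains (i.e., for every bipartition L, R of the vertex set of G, every connected component of G[L:R] is a chain graph) if and only if G has no induced subgraph H on five vertices admitting a bipartition L, R of its vertices such that H[L:R] is isomorphic to P₅; that is, quasi-Chains is precisely the class of (pre-P₅)-free graphs. -/

import Mathlib

/-- `G` is a chain graph: a bipartite graph with a bipartition `(L, Lᶜ)` such
that the neighbourhoods of the vertices of `L` are linearly ordered by
inclusion. -/
def IsChainGraph {V : Type*} (G : SimpleGraph V) : Prop :=
  ∃ L : Set V,
    (∀ v w : V, G.Adj v w → ((v ∈ L ∧ w ∉ L) ∨ (w ∈ L ∧ v ∉ L))) ∧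
    ∀ u ∈ L, ∀ v ∈ L,
      G.neighborSet u ⊆ G.neighborSet v ∨ G.neighborSet v ⊆ G.neighborSet u

/-- Every connected component of `G` is a chain graph. -/
def AllComponentsChain {V : Type*} (G : SimpleGraph V) : Prop :=
  ∀ c : G.ConnectedComponent, IsChainGraph (G.induce c.supp)

/-- `G` contains an induced copy of `H`. -/
def HasInducedCopy {V W : Type*} (G : SimpleGraph V) (H : SimpleGraph W) : Prop :=
  ∃ U : Set V, Nonempty (H ≃g G.induce U)

/-- `G` is bipartite: its vertex set splits into two independent sets. -/
def IsBipartite {V : Type*} (G : SimpleGraph V) : Prop :=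
  ∃ L : Set V, ∀ v w : V, G.Adj v w → ((v ∈ L ∧ w ∉ L) ∨ (w ∈ L ∧ v ∉ L))

/-- The bipartite graph `G[L:R]` on the vertices of `G` (with `R = Lᶜ`),
keeping exactly the edges of `G` with one endpoint in `L` and one in `R`. -/
def cutGraph {V : Type*} (G : SimpleGraph V) (L : Set V) : SimpleGraph V :=
  SimpleGraph.fromRel fun v w => G.Adj v w ∧ v ∈ L ∧ w ∉ L

theorem cutGraph_adj_iff {V : Type*} (G : SimpleGraph V) (L : Set V) (v w : V) :
    (cutGraph G L).Adj v w ↔ G.Adj v w ∧ ((v ∈ L ∧ w ∉ L) ∨ (w ∈ L ∧ v ∉ L)) := by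
  have h1 := G.adj_comm v w
  have h2 : G.Adj v w → v ≠ w := fun h => h.ne
  simp only [cutGraph, SimpleGraph.fromRel_adj]
  tauto

theorem five_path {V : Type*} (G : SimpleGraph V) (L : Set V)
    (hno : ¬ ∃ (U : Set V) (L : Set ↥U),
          Nonempty (SimpleGraph.pathGraph 5 ≃g cutGraph (G.induce U) L))
    (a b c d e : V) (hab : (cutGraph G L).Adj a b) (hbc : (cutGraph G L).Adj b c)
    (hcd : (cutGraph G L).Adj c d) (hde : (cutGraph G L).Adj d e)
    (had : ¬ (cutGraph G L).Adj a d) (hbe : ¬ (cutGraph G L).Adj b e) : False := by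
  have sym : ∀ v w, (cutGraph G L).Adj v w ↔ (cutGraph G L).Adj w v :=
    fun v w => (cutGraph G L).adj_comm v w
  have par : ∀ v w, (cutGraph G L).Adj v w → ((v ∈ L ∧ w ∉ L) ∨ (w ∈ L ∧ v ∉ L)) :=
    fun v w h => ((cutGraph_adj_iff G L v w).1 h).2
  have pab := par _ _ hab
  have pbc := par _ _ hbc
  have pcd := par _ _ hcd
  have pde := par _ _ hde
  let f : Fin 5 → V := ![a, b, c, d, e]
  have hac : a ≠ c := by rintro rfl; exact had hcd
  have hbd : b ≠ d := by rintro rfl; exact hbe hde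
  have hce : c ≠ e := by rintro rfl; exact hbe hbc
  have hae : a ≠ e := by rintro rfl; exact had ((sym _ _).1 hde)
  have nab := hab.ne
  have nbc := hbc.ne
  have ncd := hcd.ne
  have nde := hde.ne
  have nad : a ≠ d := by rintro rfl; tauto
  have nbe : b ≠ e := by rintro rfl; tauto
  have hf : Function.Injective f := by
    intro i j h
    fin_cases i <;> fin_cases j <;> simp [f] at h ⊢ <;> simp_all
  have hadj : ∀ i j, (cutGraph G L).Adj (f i) (f j) ↔ (SimpleGraph.pathGraph 5).Adj i j := by
    have nac : ¬ (cutGraph G L).Adj a c := fun h => by have := par _ _ h; tauto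
    have nonadj_bd : ¬ (cutGraph G L).Adj b d := fun h => by have := par _ _ h; tauto
    have nce : ¬ (cutGraph G L).Adj c e := fun h => by have := par _ _ h; tauto
    have nae : ¬ (cutGraph G L).Adj a e := fun h => by have := par _ _ h; tauto
    intro i j
    rw [SimpleGraph.pathGraph_adj]
    fin_cases i <;> fin_cases j <;> simp [f] <;>
      first | assumption | (rw [sym]; assumption)
  refine hno ⟨Set.range f, {x | x.1 ∈ L}, ⟨⟨Equiv.ofInjective f hf, ?_⟩⟩⟩
  intro i j
  rw [← hadj, cutGraph_adj_iff, cutGraph_adj_iff]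
  simp

theorem common_nbr {V : Type*} (G : SimpleGraph V) (L : Set V)
    (hno : ¬ ∃ (U : Set V) (L : Set ↥U),
          Nonempty (SimpleGraph.pathGraph 5 ≃g cutGraph (G.induce U) L))
    (u z : V) (hu : u ∈ L) (h : (cutGraph G L).Reachable u z) :
    (z ∈ L → u = z ∨ ∃ a, (cutGraph G L).Adj u a ∧ (cutGraph G L).Adj a z) ∧
    (z ∉ L → ∃ w, (u = w ∨ ∃ a, (cutGraph G L).Adj u a ∧ (cutGraph G L).Adj a w) ∧
      (cutGraph G L).Adj w z) := by
  rw [SimpleGraph.reachable_iff_reflTransGen] at h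
  induction h with
  | refl => exact ⟨fun _ => Or.inl rfl, fun h => absurd hu h⟩
  | @tail y z _ hyz ih =>
    have hp := ((cutGraph_adj_iff G L y z).1 hyz).2
    constructor
    · intro hz
      obtain ⟨w, hw, hwy⟩ := ih.2 (by tauto)
      rcases hw with rfl | ⟨a, hua, haw⟩
      · exact Or.inr ⟨y, hwy, hyz⟩
      · by_cases h1 : (cutGraph G L).Adj u y
        · exact Or.inr ⟨y, h1, hyz⟩
        by_cases h2 : (cutGraph G L).Adj a z
        · exact Or.inr ⟨a, hua, h2⟩
        exact (five_path G L hno u a w y z hua haw hwy hyz h1 h2).elim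
    · intro hz
      exact ⟨y, ih.1 (by tauto), hyz⟩

/-- `G` belongs to quasi-Chains (for every bipartition `L, R`
of its vertex set, every connected component of `G[L:R]` is a chain graph) if
and only if `G` has no induced subgraph `H` admitting a bipartition `L, R` of
its vertices such that `H[L:R]` is isomorphic to `P₅`;
i.e., quasi-Chains is exactly the class of (pre-`P₅`)-free graphs. -/
theorem quasiChains_iff_preP5_free {V : Type*} [Fintype V] (G : SimpleGraph V) :
    (∀ L : Set V, AllComponentsChain (cutGraph G L)) ↔
      ¬ ∃ (U : Set V) (L : Set ↥U),
          Nonempty (SimpleGraph.pathGraph 5 ≃g cutGraph (G.induce U) L) := by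
  constructor
  · rintro h ⟨U, L, ⟨φ⟩⟩
    have key : ∀ i j, (cutGraph G (Set.image Subtype.val L)).Adj (φ i).1 (φ j).1 ↔
        (SimpleGraph.pathGraph 5).Adj i j := by
      intro i j
      rw [← φ.map_rel_iff, cutGraph_adj_iff, cutGraph_adj_iff]
      simp
    obtain ⟨M, hM, hc⟩ := h (Set.image Subtype.val L)
      ((cutGraph G (Set.image Subtype.val L)).connectedComponentMk (φ 0).1)
    have hr : ∀ i, (φ i).1 ∈ ((cutGraph G (Set.image Subtype.val L)).connectedComponentMk (φ 0).1).supp := by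
      intro i
      rw [SimpleGraph.ConnectedComponent.mem_supp_iff, SimpleGraph.ConnectedComponent.eq]
      exact ((SimpleGraph.pathGraph_connected 4).preconnected i 0).map
        ⟨fun i => (φ i).1, fun {a b} hab => (key a b).2 hab⟩
    have keyM : ∀ i j, (SimpleGraph.pathGraph 5).Adj i j → _ :=
      fun i j hij => hM ⟨_, hr i⟩ ⟨_, hr j⟩ ((key i j).2 hij)
    have ncl : ∀ i j k l, (SimpleGraph.pathGraph 5).Adj i k → ¬ (SimpleGraph.pathGraph 5).Adj j k →
        (SimpleGraph.pathGraph 5).Adj j l → ¬ (SimpleGraph.pathGraph 5).Adj i l →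
        (⟨_, hr i⟩ : Set.Elem _) ∈ M → (⟨_, hr j⟩ : Set.Elem _) ∈ M → False := by
      intro i j k l hik hjk hjl hil hi hj
      rcases hc _ hi _ hj with hs | hs
      · exact hjk ((key j k).1 (@hs ⟨_, hr k⟩ ((key i k).2 hik)))
      · exact hil ((key i l).1 (@hs ⟨_, hr l⟩ ((key j l).2 hjl)))
    have e01 := keyM 0 1 (by simp [SimpleGraph.pathGraph_adj])
    have e12 := keyM 1 2 (by simp [SimpleGraph.pathGraph_adj])
    have e23 := keyM 2 3 (by simp [SimpleGraph.pathGraph_adj])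
    have e34 := keyM 3 4 (by simp [SimpleGraph.pathGraph_adj])
    have n13 := ncl 1 3 0 4 (by simp [SimpleGraph.pathGraph_adj])
      (by simp [SimpleGraph.pathGraph_adj]) (by simp [SimpleGraph.pathGraph_adj])
      (by simp [SimpleGraph.pathGraph_adj])
    have n04 := ncl 0 4 1 3 (by simp [SimpleGraph.pathGraph_adj])
      (by simp [SimpleGraph.pathGraph_adj]) (by simp [SimpleGraph.pathGraph_adj])
      (by simp [SimpleGraph.pathGraph_adj])
    tauto
  · intro hno L c
    refine ⟨{x | x.1 ∈ L}, fun v w h => ((cutGraph_adj_iff G L v w).1 h).2, ?_⟩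
    rintro ⟨u, huc⟩ hu ⟨v, hvc⟩ hv
    by_contra hcon
    rw [not_or, Set.not_subset, Set.not_subset] at hcon
    obtain ⟨⟨⟨x, _⟩, hux, hvx⟩, ⟨⟨y, _⟩, hvy, huy⟩⟩ := hcon
    simp only [SimpleGraph.mem_neighborSet, SimpleGraph.comap_adj,
      Function.Embedding.subtype_apply] at hux hvx hvy huy
    have hreach : (cutGraph G L).Reachable u v := by
      rw [← SimpleGraph.ConnectedComponent.eq]
      exact huc.trans hvc.symm
    rcases (common_nbr G L hno u v hu hreach).1 hv with rfl | ⟨w, huw, hwv⟩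
    · exact hvx hux
    · exact five_path G L hno x u w v y hux.symm huw hwv hvy (fun h => hvx h.symm) huy
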